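/- Let d ≥ 1 and let Φ: ℝ^d → ℝ be a continuous, integrable, even function whose Fourier transform Φ̂ (with convention Φ̂(ω) = (2π)^{-d/2}∫_{ℝ^d} Φ(x)e^{-iω'x}dx) is nonnegative, belongs to L¹(ℝ^d), and satisfies the inversion formula Φ(x) = (2π)^{-d/2}∫_{ℝ^d} Φ̂(ω)e^{iω'x}dω. Let x₁,…,xₙ ∈ ℝ^d be pairwise distinct, define the separation distances q_j = (1/2)·min_{k≠j} ‖x_j − x_k‖₂ and q = min_j q_j, and let c* > 0. Then for all α ∈ ℝⁿ, Σ_{j=1}^n Σ_{k=1}^n α_jα_k Φ(x_j − x_k) ≥ Υ₀(c*/q) · Σ_{j=1}^n α_j² (1 − (Γ(d/2+1)²π/18)·(q/q_j)·(12/c*)^{d+1}), where Υ₀(M) = (Φ̂_*(M)/Γ(d/2+1))·(M/2^{3/2})^d and Φ̂_*(M) = inf_{‖ω‖₂ ≤ 2M} Φ̂(ω). -/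

import Mathlib

open Matrix MeasureTheory Real

/-- The Euclidean norm of a vector in `ℝ^d`. -/
noncomputable def euclNorm {d : ℕ} (v : Fin d → ℝ) : ℝ :=
  Real.sqrt (∑ i, v i ^ 2)

/-- Half the distance from `X j` to its nearest neighbour among the other points. -/
noncomputable def sepj {d n : ℕ} (X : Fin n → (Fin d → ℝ)) (j : Fin n) : ℝ :=
  (1 / 2) * sInf {r : ℝ | ∃ k, k ≠ j ∧ r = euclNorm (X j - X k)}

/-- The separation distance of the point set `X`. -/
noncomputable def sep {d n : ℕ} (X : Fin n → (Fin d → ℝ)) : ℝ :=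
  ⨅ j, sepj X j

/-- `Φ̂_*(M) = inf_{‖ω‖₂ ≤ 2M} Φ̂(ω)`. -/
noncomputable def fourierInf {d : ℕ} (Φhat : (Fin d → ℝ) → ℝ) (M : ℝ) : ℝ :=
  sInf (Φhat '' {ω | euclNorm ω ≤ 2 * M})

/-- `Υ₀(M) = (Φ̂_*(M)/Γ(d/2+1))·(M/2^{3/2})^d`. -/
noncomputable def Upsilon0 {d : ℕ} (Φhat : (Fin d → ℝ) → ℝ) (M : ℝ) : ℝ :=
  (fourierInf Φhat M / Real.Gamma ((d : ℝ) / 2 + 1)) * (M / 2 ^ ((3 : ℝ) / 2)) ^ d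

lemma euclNorm_eq_norm {d : ℕ} (v : Fin d → ℝ) : euclNorm v = ‖WithLp.toLp 2 v‖ := by
  simp [euclNorm, EuclideanSpace.norm_eq]

lemma euclNorm_nonneg {d : ℕ} (v : Fin d → ℝ) : 0 ≤ euclNorm v := Real.sqrt_nonneg _

lemma euclNorm_sq {d : ℕ} (v : Fin d → ℝ) : euclNorm v ^ 2 = ∑ i, v i ^ 2 :=
  Real.sq_sqrt (by positivity)

lemma euclNorm_add_le {d : ℕ} (v w : Fin d → ℝ) : euclNorm (v + w) ≤ euclNorm v + euclNorm w := by
  simp only [euclNorm_eq_norm, WithLp.toLp_add]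
  exact norm_add_le _ _

lemma euclNorm_sub_comm {d : ℕ} (v w : Fin d → ℝ) : euclNorm (v - w) = euclNorm (w - v) := by
  simp only [euclNorm_eq_norm, WithLp.toLp_sub]
  exact norm_sub_rev _ _

lemma euclNorm_pos {d : ℕ} {v : Fin d → ℝ} (hv : v ≠ 0) : 0 < euclNorm v := by
  rw [euclNorm_eq_norm]
  simpa using hv

lemma continuous_euclNorm {d : ℕ} : Continuous (euclNorm : (Fin d → ℝ) → ℝ) := by
  unfold euclNorm
  fun_prop

lemma gaussian_mul_cexp_eq {d : ℕ} (b : ℝ) (x v : Fin d → ℝ) :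
    Complex.exp (-∑ i, (b : ℂ) * (v i : ℂ) ^ 2 + ∑ i, (x i * Complex.I) * v i) =
      (Real.exp (-b * euclNorm v ^ 2) : ℂ) * Complex.exp ((∑ i, v i * x i : ℝ) * Complex.I) := by
  rw [euclNorm_sq, Complex.ofReal_exp, ← Complex.exp_add]
  congr 1
  push_cast
  rw [Finset.sum_mul, Finset.mul_sum, ← Finset.sum_neg_distrib]
  congr 1
  · exact Finset.sum_congr rfl fun i _ => by ring
  · exact Finset.sum_congr rfl fun i _ => by ring

lemma re_gaussian_mul_cexp {d : ℕ} (b : ℝ) (x v : Fin d → ℝ) :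
    (Complex.exp (-∑ i, (b : ℂ) * (v i : ℂ) ^ 2 + ∑ i, (x i * Complex.I) * v i)).re =
      Real.exp (-b * euclNorm v ^ 2) * Real.cos (∑ i, v i * x i) := by
  rw [gaussian_mul_cexp_eq, Complex.re_ofReal_mul, Complex.exp_ofReal_mul_I_re]

lemma integrable_gaussian_mul_cos {d : ℕ} {b : ℝ} (hb : 0 < b) (x : Fin d → ℝ) :
    Integrable fun v : Fin d → ℝ =>
      Real.exp (-b * euclNorm v ^ 2) * Real.cos (∑ i, v i * x i) := by
  have h := (GaussianFourier.integrable_cexp_neg_sum_mul_add (b := fun _ : Fin d => (b : ℂ))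
    (fun _ => by simpa using hb) fun i => x i * Complex.I).re
  simpa only [RCLike.re_eq_complex_re, re_gaussian_mul_cexp] using h

lemma integral_gaussian_mul_cos {d : ℕ} {b : ℝ} (hb : 0 < b) (x : Fin d → ℝ) :
    ∫ v : Fin d → ℝ, Real.exp (-b * euclNorm v ^ 2) * Real.cos (∑ i, v i * x i) =
      √(π / b) ^ d * Real.exp (-(euclNorm x ^ 2) / (4 * b)) := by
  have hint := GaussianFourier.integrable_cexp_neg_sum_mul_add (b := fun _ : Fin d => (b : ℂ))
    (fun _ => by simpa using hb) fun i => x i * Complex.I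
  have h := GaussianFourier.integral_cexp_neg_sum_mul_add (b := fun _ : Fin d => (b : ℂ))
    (fun _ => by simpa using hb) fun i => x i * Complex.I
  have hsqrt : ((π : ℂ) / (b : ℂ)) ^ (1 / 2 : ℂ) = ((√(π / b) : ℝ) : ℂ) := by
    rw [Real.sqrt_eq_rpow, Complex.ofReal_cpow (by positivity)]
    push_cast
    rfl
  have hprod : ∏ i : Fin d, ((π : ℂ) / (b : ℂ)) ^ (1 / 2 : ℂ) *
      Complex.exp ((x i * Complex.I) ^ 2 / (4 * b)) =
      ((√(π / b) ^ d * Real.exp (-(euclNorm x ^ 2) / (4 * b)) : ℝ) : ℂ) := by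
    rw [Finset.prod_mul_distrib, ← Complex.exp_sum, hsqrt, euclNorm_sq]
    simp only [Finset.prod_const, Finset.card_univ, Fintype.card_fin, mul_pow, Complex.I_sq]
    push_cast
    rw [← Finset.sum_neg_distrib, Finset.sum_div]
    simp
  rw [hprod] at h
  have h2 := integral_re hint
  simp only [RCLike.re_eq_complex_re, re_gaussian_mul_cexp] at h2
  rw [h2, h, Complex.ofReal_re]

lemma integrable_gaussian {d : ℕ} {b : ℝ} (hb : 0 < b) :
    Integrable fun v : Fin d → ℝ => Real.exp (-b * euclNorm v ^ 2) := by
  simpa using integrable_gaussian_mul_cos hb (0 : Fin d → ℝ)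

lemma integral_gaussian_euclNorm {d : ℕ} {b : ℝ} (hb : 0 < b) :
    ∫ v : Fin d → ℝ, Real.exp (-b * euclNorm v ^ 2) = √(π / b) ^ d := by
  simpa [euclNorm] using integral_gaussian_mul_cos hb (0 : Fin d → ℝ)

lemma volume_euclNorm_ball {d : ℕ} (hd : 1 ≤ d) (z : Fin d → ℝ) (r : ℝ) :
    volume {v : Fin d → ℝ | euclNorm (v - z) < r} =
      ENNReal.ofReal r ^ d * ENNReal.ofReal (√π ^ d / Real.Gamma ((d : ℝ) / 2 + 1)) := by
  have : Nonempty (Fin d) := ⟨⟨0, hd⟩⟩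
  have h := EuclideanSpace.volume_ball (Fin d) (WithLp.toLp 2 z) r
  rw [← (PiLp.volume_preserving_toLp (Fin d)).measure_preimage
    measurableSet_ball.nullMeasurableSet, Fintype.card_fin] at h
  rw [← h]
  congr 1
  ext v
  simp [euclNorm_eq_norm, dist_eq_norm]

lemma Gamma_half_pos (d : ℕ) : 0 < Real.Gamma ((d : ℝ) / 2 + 1) :=
  Real.Gamma_pos_of_pos (by positivity)

lemma volume_real_euclNorm_ball {d : ℕ} (hd : 1 ≤ d) (z : Fin d → ℝ) {r : ℝ} (hr : 0 ≤ r) :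
    volume.real {v : Fin d → ℝ | euclNorm (v - z) < r} =
      r ^ d * (√π ^ d / Real.Gamma ((d : ℝ) / 2 + 1)) := by
  have := Gamma_half_pos d
  rw [measureReal_def, volume_euclNorm_ball hd, ENNReal.toReal_mul, ENNReal.toReal_pow,
    ENNReal.toReal_ofReal hr, ENNReal.toReal_ofReal (by positivity)]

lemma volume_euclNorm_ball_ne_top {d : ℕ} (hd : 1 ≤ d) (z : Fin d → ℝ) (r : ℝ) :
    volume {v : Fin d → ℝ | euclNorm (v - z) < r} ≠ ⊤ := by
  rw [volume_euclNorm_ball hd]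
  exact ENNReal.mul_ne_top (ENNReal.pow_ne_top ENNReal.ofReal_ne_top) ENNReal.ofReal_ne_top

lemma measurableSet_euclNorm_ball {d : ℕ} (z : Fin d → ℝ) (r : ℝ) :
    MeasurableSet {v : Fin d → ℝ | euclNorm (v - z) < r} :=
  measurableSet_lt (continuous_euclNorm.comp (by fun_prop)).measurable measurable_const

/-- Comparison of a Gaussian sum over `2q`-separated points with a Gaussian integral. -/
lemma sum_gaussian_mul_ball_volume_le {d : ℕ} (hd : 1 ≤ d) {ι : Type*} (s : Finset ι)
    (Y : ι → Fin d → ℝ) (z : Fin d → ℝ) {q b : ℝ} (hq : 0 < q) (hb : 0 < b)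
    (hsep : ∀ k ∈ s, ∀ l ∈ s, k ≠ l → 2 * q ≤ euclNorm (Y k - Y l))
    (hz : ∀ k ∈ s, 2 * q ≤ euclNorm (z - Y k)) :
    (∑ k ∈ s, Real.exp (-(9 / 4 * b) * euclNorm (z - Y k) ^ 2)) *
      (q ^ d * (√π ^ d / Real.Gamma ((d : ℝ) / 2 + 1))) ≤ √(π / b) ^ d := by
  set B : ι → Set (Fin d → ℝ) := fun k => {v | euclNorm (v - Y k) < q} with hB
  set f : (Fin d → ℝ) → ℝ := fun v => Real.exp (-b * euclNorm (v - z) ^ 2) with hf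
  have hfint : Integrable f := (integrable_gaussian hb).comp_sub_right z
  have hftot : ∫ v, f v = √(π / b) ^ d := by
    rw [hf, integral_sub_right_eq_self (fun v => Real.exp (-b * euclNorm v ^ 2)) z,
      integral_gaussian_euclNorm hb]
  have hdisj : (s : Set ι).Pairwise (Function.onFun Disjoint B) := by
    intro k hk l hl hkl
    refine Set.disjoint_left.2 fun v hvk hvl => ?_
    have h1 := hsep k hk l hl hkl
    have h2 := euclNorm_add_le (Y k - v) (v - Y l)
    rw [sub_add_sub_cancel, euclNorm_sub_comm (Y k) v] at h2
    simp only [hB, Set.mem_ofPred_eq] at hvk hvl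
    linarith
  have hball : ∀ k ∈ s, Real.exp (-(9 / 4 * b) * euclNorm (z - Y k) ^ 2) *
      (q ^ d * (√π ^ d / Real.Gamma ((d : ℝ) / 2 + 1))) ≤ ∫ v in B k, f v := by
    intro k hk
    rw [← volume_real_euclNorm_ball hd (Y k) hq.le]
    refine setIntegral_ge_of_const_le_real (measurableSet_euclNorm_ball _ _)
      (volume_euclNorm_ball_ne_top hd _ _) (fun v hv => ?_) hfint.integrableOn
    have h1 := hz k hk
    have h2 := euclNorm_add_le (v - Y k) (Y k - z)
    rw [sub_add_sub_cancel, euclNorm_sub_comm (Y k) z] at h2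
    simp only [Set.mem_ofPred_eq] at hv
    have h3 : euclNorm (v - z) ≤ 3 / 2 * euclNorm (z - Y k) := by linarith
    have h4 := pow_le_pow_left₀ (euclNorm_nonneg _) h3 2
    refine Real.exp_le_exp.2 ?_
    nlinarith
  calc _ = ∑ k ∈ s, Real.exp (-(9 / 4 * b) * euclNorm (z - Y k) ^ 2) *
      (q ^ d * (√π ^ d / Real.Gamma ((d : ℝ) / 2 + 1))) := Finset.sum_mul _ _ _
    _ ≤ ∑ k ∈ s, ∫ v in B k, f v := Finset.sum_le_sum hball
    _ = ∫ v in ⋃ k ∈ s, B k, f v :=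
      (integral_biUnion_finset s (fun k _ => measurableSet_euclNorm_ball _ _) hdisj
        fun k _ => hfint.integrableOn).symm
    _ ≤ ∫ v, f v := setIntegral_le_integral hfint (ae_of_all _ fun v => (Real.exp_pos _).le)
    _ = _ := hftot

lemma sqrt_pow_le_Gamma_mul {d : ℕ} (hd : 1 ≤ d) :
    √(d : ℝ) ^ d ≤ Real.Gamma ((d : ℝ) / 2 + 1) * √(2 * Real.exp 1) ^ d := by
  have hG := Gamma_half_pos d
  have hd0 : (0 : ℝ) < d := by exact_mod_cast hd
  have hint : Integrable fun v : Fin d → ℝ => Real.exp (-((d : ℝ) / 2) * euclNorm (v - 0) ^ 2) := by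
    simpa using integrable_gaussian (d := d) (half_pos hd0)
  have h1 := setIntegral_ge_of_const_le_real (c := Real.exp (-((d : ℝ) / 2)))
    (measurableSet_euclNorm_ball (0 : Fin d → ℝ) 1) (volume_euclNorm_ball_ne_top hd _ _)
    (fun v hv => by
      have h2 := pow_le_pow_left₀ (euclNorm_nonneg _) (le_of_lt hv) 2
      refine Real.exp_le_exp.2 ?_
      nlinarith) hint.integrableOn
  have h2 := h1.trans (setIntegral_le_integral hint (ae_of_all _ fun v => (Real.exp_pos _).le))
  rw [volume_real_euclNorm_ball hd _ zero_le_one, one_pow, one_mul] at h2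
  simp only [sub_zero] at h2
  rw [integral_gaussian_euclNorm (half_pos hd0)] at h2
  have he : Real.exp (-((d : ℝ) / 2)) = (√(Real.exp 1) ^ d)⁻¹ := by
    rw [Real.exp_neg, ← Real.exp_half, ← Real.exp_nat_mul]
    congr 2
    ring
  have hs : √(π / (d / 2)) = √π * √2 / √d := by
    rw [← Real.sqrt_mul (by positivity), ← Real.sqrt_div (by positivity)]
    congr 1
    field_simp
  rw [he, hs, div_pow, mul_pow] at h2
  rw [Real.sqrt_mul (by positivity), mul_pow]
  have hp : 0 < √π ^ d := by positivity
  have hdp : 0 < √(d : ℝ) ^ d := by positivity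
  have hep : 0 < √(Real.exp 1) ^ d := by positivity
  rw [inv_mul_eq_div, div_div, div_le_div_iff₀ (by positivity) hdp] at h2
  refine le_of_mul_le_mul_left ?_ hp
  linarith

/-- The constant term of the Gaussian minorant dominates the volume term. -/
lemma sqrt_pow_le_Gamma_mul_one_sub {d : ℕ} (hd : 1 ≤ d) :
    √(d : ℝ) ^ d ≤ Real.Gamma ((d : ℝ) / 2 + 1) * ((1 - (√2 / Real.exp 1) ^ d) * (2 * √2) ^ d) := by
  have hG := Gamma_half_pos d
  have he1 := Real.exp_one_gt_d9
  have he2 := Real.exp_one_lt_d9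
  have hs2 : √2 ^ 2 = (2 : ℝ) := Real.sq_sqrt (by norm_num)
  have hs2p : 0 < √(2 : ℝ) := by positivity
  obtain rfl | hd2 := hd.eq_or_lt
  · have hg : Real.Gamma (((1 : ℕ) : ℝ) / 2 + 1) = √π / 2 := by
      have := Real.Gamma_add_one (s := 1 / 2) (by norm_num)
      rw [Real.Gamma_one_half_eq] at this
      simp only [Nat.cast_one, this]
      ring
    have hpi : (1.77 : ℝ) ≤ √π :=
      Real.le_sqrt_of_sq_le (by nlinarith [Real.pi_gt_d2])
    have h14 : (1.414 : ℝ) ≤ √2 := Real.le_sqrt_of_sq_le (by norm_num)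
    have h15 : √2 ≤ (1.4143 : ℝ) := Real.sqrt_le_iff.2 (by norm_num)
    have hk : √2 / Real.exp 1 ≤ 0.521 := by
      rw [div_le_iff₀ (Real.exp_pos 1)]
      linarith
    rw [hg]
    simp only [Nat.cast_one, Real.sqrt_one, pow_one]
    have h3 : (0.479 : ℝ) * 2.828 ≤ (1 - √2 / Real.exp 1) * (2 * √2) :=
      mul_le_mul (by linarith) (by linarith) (by norm_num) (by linarith)
    have h4 : (0.885 : ℝ) * (0.479 * 2.828) ≤ √π / 2 * ((1 - √2 / Real.exp 1) * (2 * √2)) :=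
      mul_le_mul (by linarith) h3 (by norm_num) (by positivity)
    linarith
  · refine (sqrt_pow_le_Gamma_mul hd).trans (mul_le_mul_of_nonneg_left ?_ hG.le)
    set p := √(Real.exp 1) / 2 with hp
    set r := √2 / Real.exp 1 with hr
    have hp0 : 0 ≤ p := by positivity
    have hr0 : 0 ≤ r := by positivity
    have hpsq : p ^ 2 ≤ 0.68 := by
      rw [hp, div_pow, Real.sq_sqrt (Real.exp_pos 1).le]
      linarith
    have hrsq : r ^ 2 ≤ 0.28 := by
      rw [hr, div_pow, hs2, div_le_iff₀ (by positivity)]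
      nlinarith
    have hpd : p ^ d ≤ p ^ 2 := pow_le_pow_of_le_one hp0 (by nlinarith) hd2
    have hrd : r ^ d ≤ r ^ 2 := pow_le_pow_of_le_one hr0 (by nlinarith) hd2
    have h5 : √(2 * Real.exp 1) = p * (2 * √2) := by
      rw [Real.sqrt_mul (by norm_num), hp]
      ring
    rw [h5, mul_pow]
    exact mul_le_mul_of_nonneg_right (by linarith) (by positivity)

lemma two_mul_sepj_le {d n : ℕ} (X : Fin n → (Fin d → ℝ)) {j k : Fin n} (h : k ≠ j) :
    2 * sepj X j ≤ euclNorm (X j - X k) := by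
  have : sInf {r : ℝ | ∃ k, k ≠ j ∧ r = euclNorm (X j - X k)} ≤ euclNorm (X j - X k) :=
    csInf_le ⟨0, by rintro r ⟨l, -, rfl⟩; exact euclNorm_nonneg _⟩ ⟨k, h, rfl⟩
  unfold sepj
  linarith

lemma sepj_pos {d n : ℕ} (hn : 2 ≤ n) {X : Fin n → (Fin d → ℝ)} (hX : Function.Injective X)
    (j : Fin n) : 0 < sepj X j := by
  set S := {r : ℝ | ∃ k, k ≠ j ∧ r = euclNorm (X j - X k)} with hS
  have hfin : S.Finite := by
    refine (Set.finite_range fun k => euclNorm (X j - X k)).subset ?_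
    rintro r ⟨k, -, rfl⟩
    exact ⟨k, rfl⟩
  have : Nontrivial (Fin n) := Fin.nontrivial_iff_two_le.2 hn
  obtain ⟨k, hk⟩ := exists_ne j
  have hne : S.Nonempty := ⟨_, k, hk, rfl⟩
  obtain ⟨l, hl, hr⟩ := hne.csInf_mem hfin
  have : 0 < sInf S := by
    rw [hr]
    exact euclNorm_pos (sub_ne_zero.2 fun h => hl (hX h).symm)
  unfold sepj
  linarith

lemma sep_le_sepj {d n : ℕ} (X : Fin n → (Fin d → ℝ)) (j : Fin n) : sep X ≤ sepj X j :=
  ciInf_le (Set.finite_range _).bddBelow j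

lemma sep_pos {d n : ℕ} (hn : 2 ≤ n) {X : Fin n → (Fin d → ℝ)} (hX : Function.Injective X) :
    0 < sep X := by
  have : Nonempty (Fin n) := ⟨⟨0, by omega⟩⟩
  obtain ⟨j, hj⟩ := exists_eq_ciInf_of_finite (f := sepj X)
  rw [sep, ← hj]
  exact sepj_pos hn hX j

/-- A difference of Gaussians, at most `1` everywhere and nonpositive where
`2 * d ≤ b * ‖v‖ ^ 2`. -/
noncomputable def gaussianMinorant {d : ℕ} (b : ℝ) (v : Fin d → ℝ) : ℝ :=
  Real.exp (-b * euclNorm v ^ 2) - Real.exp (-(d : ℝ)) * Real.exp (-(b / 2) * euclNorm v ^ 2)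

/-- The cosine transform of `gaussianMinorant`. -/
noncomputable def gaussianMinorantTransform {d : ℕ} (b : ℝ) (x : Fin d → ℝ) : ℝ :=
  √(π / b) ^ d * (Real.exp (-(euclNorm x ^ 2) / (4 * b)) -
    (√2 / Real.exp 1) ^ d * Real.exp (-(euclNorm x ^ 2) / (4 * b)) ^ 2)

lemma gaussianMinorant_le_one {d : ℕ} {b : ℝ} (hb : 0 < b) (v : Fin d → ℝ) :
    gaussianMinorant b v ≤ 1 := by
  have h1 : Real.exp (-b * euclNorm v ^ 2) ≤ 1 :=
    Real.exp_le_one_iff.2 (by nlinarith [sq_nonneg (euclNorm v)])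
  have h2 : 0 ≤ Real.exp (-(d : ℝ)) * Real.exp (-(b / 2) * euclNorm v ^ 2) := by positivity
  unfold gaussianMinorant
  linarith

lemma gaussianMinorant_nonpos {d : ℕ} {b : ℝ} {v : Fin d → ℝ}
    (h : 2 * (d : ℝ) ≤ b * euclNorm v ^ 2) : gaussianMinorant b v ≤ 0 := by
  rw [gaussianMinorant, ← Real.exp_add, sub_nonpos, Real.exp_le_exp]
  linarith

lemma integrable_gaussianMinorant {d : ℕ} {b : ℝ} (hb : 0 < b) :
    Integrable (gaussianMinorant b : (Fin d → ℝ) → ℝ) :=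
  (integrable_gaussian hb).sub ((integrable_gaussian (half_pos hb)).const_mul _)

lemma integral_gaussianMinorant_mul_cos {d : ℕ} {b : ℝ} (hb : 0 < b) (x : Fin d → ℝ) :
    ∫ v, gaussianMinorant b v * Real.cos (∑ i, v i * x i) = gaussianMinorantTransform b x := by
  have h1 := integrable_gaussian_mul_cos hb x
  have h2 := (integrable_gaussian_mul_cos (half_pos hb) x).const_mul (Real.exp (-(d : ℝ)))
  have h3 : ∀ v : Fin d → ℝ, gaussianMinorant b v * Real.cos (∑ i, v i * x i) =
      Real.exp (-b * euclNorm v ^ 2) * Real.cos (∑ i, v i * x i) -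
      Real.exp (-(d : ℝ)) *
        (Real.exp (-(b / 2) * euclNorm v ^ 2) * Real.cos (∑ i, v i * x i)) := by
    intro v
    unfold gaussianMinorant
    ring
  simp only [h3]
  rw [integral_sub h1 h2, integral_const_mul, integral_gaussian_mul_cos hb,
    integral_gaussian_mul_cos (half_pos hb), gaussianMinorantTransform]
  have hs : √(π / (b / 2)) = √2 * √(π / b) := by
    rw [← Real.sqrt_mul (by norm_num)]
    congr 1
    field_simp
  have he : Real.exp (-(euclNorm x ^ 2) / (4 * (b / 2))) =
      Real.exp (-(euclNorm x ^ 2) / (4 * b)) ^ 2 := by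
    rw [← Real.exp_nat_mul]
    congr 1
    field_simp
    norm_num
  have hd : Real.exp (-(d : ℝ)) = (Real.exp 1 ^ d)⁻¹ := by
    rw [Real.exp_neg, ← Real.exp_nat_mul, mul_one]
  rw [hs, he, hd, mul_pow, div_pow]
  field_simp

lemma sqrt_two_div_exp_one_le_one : √2 / Real.exp 1 ≤ 1 := by
  rw [div_le_one (Real.exp_pos 1)]
  have h1 : √2 ≤ (2 : ℝ) := Real.sqrt_le_iff.2 (by norm_num)
  linarith [Real.exp_one_gt_two]

lemma gaussianMinorantTransform_nonneg {d : ℕ} {b : ℝ} (hb : 0 < b) (x : Fin d → ℝ) :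
    0 ≤ gaussianMinorantTransform b x := by
  have hE0 := Real.exp_pos (-(euclNorm x ^ 2) / (4 * b))
  have hE1 : Real.exp (-(euclNorm x ^ 2) / (4 * b)) ≤ 1 :=
    Real.exp_le_one_iff.2 (div_nonpos_of_nonpos_of_nonneg (by nlinarith [euclNorm_nonneg x])
      (by positivity))
  have hk : (√2 / Real.exp 1) ^ d ≤ 1 := pow_le_one₀ (by positivity) sqrt_two_div_exp_one_le_one
  refine mul_nonneg (by positivity) (sub_nonneg.2 ?_)
  calc _ ≤ 1 * Real.exp (-(euclNorm x ^ 2) / (4 * b)) ^ 2 :=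
        mul_le_mul_of_nonneg_right hk (by positivity)
    _ ≤ _ := by nlinarith

lemma gaussianMinorantTransform_le {d : ℕ} {b r : ℝ} (hb : 0 < b) (hr : 0 < r) {x : Fin d → ℝ}
    (hx : 2 * r ≤ euclNorm x) :
    gaussianMinorantTransform b x ≤
      √(π / b) ^ d * (√b / r * Real.exp (-(9 / 4 * (1 / (18 * b))) * euclNorm x ^ 2)) := by
  set ρ := euclNorm x
  have hsb : 0 < √b := Real.sqrt_pos.2 hb
  have hsq : √b ^ 2 = b := Real.sq_sqrt hb.le
  set E := Real.exp (-(9 / 4 * (1 / (18 * b))) * ρ ^ 2) with hE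
  have hEE : Real.exp (-(ρ ^ 2) / (4 * b)) = E * E := by
    rw [hE, ← Real.exp_add]
    congr 1
    field_simp
    ring
  have hE0 : 0 < E := Real.exp_pos _
  have hρE : ρ * E ≤ 2 * √b := by
    have hEinv : E = (Real.exp ((ρ / (2 * √b)) ^ 2 / 2))⁻¹ := by
      rw [hE, ← Real.exp_neg]
      congr 1
      rw [div_pow, mul_pow, hsq]
      field_simp
      ring
    have h1 := Real.add_one_le_exp ((ρ / (2 * √b)) ^ 2 / 2)
    have h2 : ρ / (2 * √b) ≤ Real.exp ((ρ / (2 * √b)) ^ 2 / 2) := by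
      nlinarith [sq_nonneg (ρ / (2 * √b) - 1)]
    rw [div_le_iff₀ (by positivity)] at h2
    rw [hEinv, ← div_eq_mul_inv, div_le_iff₀ (Real.exp_pos _)]
    linarith
  have hrE : E ≤ √b / r := by
    rw [le_div_iff₀ hr]
    nlinarith
  refine mul_le_mul_of_nonneg_left ?_ (by positivity)
  rw [hEE]
  have h3 : 0 ≤ (√2 / Real.exp 1) ^ d * (E * E) ^ 2 := by positivity
  nlinarith

lemma sum_gaussianMinorantTransform_le {d n : ℕ} (hd : 1 ≤ d) (hn : 2 ≤ n)
    {X : Fin n → (Fin d → ℝ)} (hX : Function.Injective X) {b : ℝ} (hb : 0 < b) (j : Fin n) :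
    ∑ k ∈ Finset.univ.erase j, gaussianMinorantTransform b (X j - X k) ≤
      √π ^ d * √18 ^ d * Real.Gamma ((d : ℝ) / 2 + 1) * √b / (sepj X j * sep X ^ d) := by
  have hG := Gamma_half_pos d
  have hq := sep_pos hn hX
  have hr := sepj_pos hn hX j
  have hpack := sum_gaussian_mul_ball_volume_le hd (Finset.univ.erase j) X (X j) hq
    (b := 1 / (18 * b)) (by positivity)
    (fun k _ l _ hkl => by linarith [two_mul_sepj_le X hkl.symm, sep_le_sepj X k])
    (fun k hk => by
      linarith [two_mul_sepj_le X (Finset.ne_of_mem_erase hk), sep_le_sepj X j])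
  set S := ∑ k ∈ Finset.univ.erase j,
    Real.exp (-(9 / 4 * (1 / (18 * b))) * euclNorm (X j - X k) ^ 2)
  have hsum : ∑ k ∈ Finset.univ.erase j, gaussianMinorantTransform b (X j - X k) ≤
      √(π / b) ^ d * (√b / sepj X j * S) := by
    rw [Finset.mul_sum, Finset.mul_sum]
    exact Finset.sum_le_sum fun k hk =>
      gaussianMinorantTransform_le hb hr (two_mul_sepj_le X (Finset.ne_of_mem_erase hk))
  have hs1 : √(π / (1 / (18 * b))) = √π * √18 * √b := by
    rw [← Real.sqrt_mul (by positivity), ← Real.sqrt_mul (by positivity)]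
    congr 1
    field_simp
  have hs2 : √(π / b) = √π / √b := Real.sqrt_div (by positivity) _
  rw [hs1] at hpack
  have hS : S ≤ √18 ^ d * √b ^ d * Real.Gamma ((d : ℝ) / 2 + 1) / sep X ^ d := by
    rw [le_div_iff₀ (by positivity)]
    rw [mul_pow, mul_pow] at hpack
    have hp : 0 < √π ^ d := by positivity
    refine le_of_mul_le_mul_left ?_ hp
    have := mul_le_mul_of_nonneg_right hpack hG.le
    calc √π ^ d * (S * sep X ^ d) = S * (sep X ^ d * (√π ^ d / Real.Gamma ((d : ℝ) / 2 + 1))) *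
          Real.Gamma ((d : ℝ) / 2 + 1) := by field_simp
      _ ≤ _ := this
      _ = _ := by ring
  refine hsum.trans ((mul_le_mul_of_nonneg_left (mul_le_mul_of_nonneg_left hS
    (by positivity)) (by positivity)).trans_eq ?_)
  rw [hs2, div_pow]
  have : √b ≠ 0 := (Real.sqrt_pos.2 hb).ne'
  field_simp

/-- Diagonal-dominance bound for a symmetric kernel matrix with nonnegative entries. -/
lemma sum_sq_mul_le_quadratic_form {ι : Type*} [Fintype ι] [DecidableEq ι] (W : ι → ι → ℝ)
    (hsymm : ∀ j k, W j k = W k j) (hnonneg : ∀ j k, 0 ≤ W j k) (α : ι → ℝ) :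
    ∑ j, α j ^ 2 * (W j j - ∑ k ∈ Finset.univ.erase j, W j k) ≤
      ∑ j, ∑ k, α j * α k * W j k := by
  have hrow : ∀ j, W j j - ∑ k ∈ Finset.univ.erase j, W j k = 2 * W j j - ∑ k, W j k := by
    intro j
    rw [← Finset.add_sum_erase _ _ (Finset.mem_univ j)]
    ring
  have hswap : ∑ j, ∑ k, α k ^ 2 * W j k = ∑ j, ∑ k, α j ^ 2 * W j k := by
    rw [Finset.sum_comm]
    simp only [hsymm]
  have hdiag : ∀ j, 4 * (α j ^ 2 * W j j) ≤ ∑ k, (α j + α k) ^ 2 * W j k := by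
    intro j
    refine le_trans (le_of_eq ?_) (Finset.single_le_sum
      (f := fun k => (α j + α k) ^ 2 * W j k)
      (fun k _ => mul_nonneg (sq_nonneg _) (hnonneg j k)) (Finset.mem_univ j))
    ring
  have h1 := Finset.sum_le_sum fun j (_ : j ∈ Finset.univ) => hdiag j
  have h2 : ∑ j, ∑ k, (α j + α k) ^ 2 * W j k =
      2 * ∑ j, ∑ k, α j ^ 2 * W j k + 2 * ∑ j, ∑ k, α j * α k * W j k := by
    have h3 : ∑ j, ∑ k, (α j + α k) ^ 2 * W j k = ∑ j, ∑ k, α j ^ 2 * W j k +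
        ∑ j, ∑ k, α k ^ 2 * W j k + 2 * ∑ j, ∑ k, α j * α k * W j k := by
      simp only [Finset.mul_sum, ← Finset.sum_add_distrib]
      exact Finset.sum_congr rfl fun j _ => Finset.sum_congr rfl fun k _ => by ring
    rw [h3, hswap]
    ring
  have h4 : ∑ j, α j ^ 2 * (W j j - ∑ k ∈ Finset.univ.erase j, W j k) =
      2 * ∑ j, α j ^ 2 * W j j - ∑ j, ∑ k, α j ^ 2 * W j k := by
    simp only [hrow, Finset.mul_sum, ← Finset.sum_sub_distrib, mul_sub]
    exact Finset.sum_congr rfl fun j _ => by ring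
  rw [← Finset.mul_sum] at h1
  linarith

lemma integrable_mul_cos {d : ℕ} {D : (Fin d → ℝ) → ℝ} (hD : Integrable D) (x : Fin d → ℝ) :
    Integrable fun v => D v * Real.cos (∑ i, v i * x i) :=
  hD.mul_bdd (c := 1) (Continuous.aestronglyMeasurable (by fun_prop))
    (ae_of_all _ fun v => by simpa using Real.abs_cos_le_one _)

/-- The cosine transform of a nonnegative integrable function is positive semidefinite. -/
lemma quadratic_form_cos_transform_nonneg {d n : ℕ} {D : (Fin d → ℝ) → ℝ} (hD : Integrable D)
    (hD0 : ∀ v, 0 ≤ D v) (X : Fin n → (Fin d → ℝ)) (α : Fin n → ℝ) :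
    0 ≤ ∑ j, ∑ k, α j * α k * ∫ v, D v * Real.cos (∑ i, v i * (X j - X k) i) := by
  have hpoint : ∀ v, ∑ j, ∑ k, α j * α k * (D v * Real.cos (∑ i, v i * (X j - X k) i)) =
      D v * ((∑ j, α j * Real.cos (∑ i, v i * X j i)) ^ 2 +
        (∑ j, α j * Real.sin (∑ i, v i * X j i)) ^ 2) := by
    intro v
    rw [sq, sq, Finset.sum_mul_sum, Finset.sum_mul_sum, ← Finset.sum_add_distrib, Finset.mul_sum]
    refine Finset.sum_congr rfl fun j _ => ?_
    rw [← Finset.sum_add_distrib, Finset.mul_sum]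
    refine Finset.sum_congr rfl fun k _ => ?_
    simp only [Pi.sub_apply, mul_sub, Finset.sum_sub_distrib, Real.cos_sub]
    ring
  have hint : ∀ j k, Integrable fun v =>
      α j * α k * (D v * Real.cos (∑ i, v i * (X j - X k) i)) := fun j k =>
    (integrable_mul_cos hD (X j - X k)).const_mul _
  simp only [← integral_const_mul]
  have hsum : ∑ j, ∑ k, ∫ v, α j * α k * (D v * Real.cos (∑ i, v i * (X j - X k) i)) =
      ∫ v, ∑ j, ∑ k, α j * α k * (D v * Real.cos (∑ i, v i * (X j - X k) i)) := by
    rw [integral_finsetSum _ fun j _ => integrable_finsetSum _ fun k _ => hint j k]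
    exact Finset.sum_congr rfl fun j _ => (integral_finsetSum _ fun k _ => hint j k).symm
  rw [hsum]
  refine integral_nonneg fun v => ?_
  simp only [hpoint]
  exact mul_nonneg (hD0 v) (by positivity)

lemma eq_cos_transform_of_inversion {d : ℕ} {Φ Φhat : (Fin d → ℝ) → ℝ} {P : ℝ}
    (hint : Integrable Φhat) (x : Fin d → ℝ)
    (h : (Φ x : ℂ) = (P : ℂ) *
      ∫ ω, (Φhat ω : ℂ) * Complex.exp (Complex.I * ((∑ i, ω i * x i : ℝ) : ℂ))) :
    Φ x = P * ∫ ω, Φhat ω * Real.cos (∑ i, ω i * x i) := by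
  have hc : Integrable fun ω : Fin d → ℝ =>
      (Φhat ω : ℂ) * Complex.exp (Complex.I * ((∑ i, ω i * x i : ℝ) : ℂ)) := by
    refine hint.ofReal.mul_bdd (c := 1) (Continuous.aestronglyMeasurable (by fun_prop))
      (ae_of_all _ fun v => ?_)
    rw [mul_comm, Complex.norm_exp_ofReal_mul_I]
  have h2 := congrArg Complex.re h
  rw [Complex.ofReal_re, Complex.re_ofReal_mul] at h2
  rw [h2]
  have h3 := integral_re hc
  simp only [RCLike.re_eq_complex_re] at h3
  rw [← h3]
  congr 2
  ext v
  rw [Complex.re_ofReal_mul, mul_comm Complex.I, Complex.exp_ofReal_mul_I_re]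

lemma fourierInf_nonneg {d : ℕ} {Φhat : (Fin d → ℝ) → ℝ} (h : ∀ ω, 0 ≤ Φhat ω) (M : ℝ) :
    0 ≤ fourierInf Φhat M := by
  refine Real.sInf_nonneg ?_
  rintro _ ⟨ω, -, rfl⟩
  exact h ω

lemma fourierInf_mul_gaussianMinorant_le {d : ℕ} (hd : 1 ≤ d) {Φhat : (Fin d → ℝ) → ℝ}
    (h : ∀ ω, 0 ≤ Φhat ω) {M : ℝ} (hM : 0 < M) (ω : Fin d → ℝ) :
    fourierInf Φhat M * gaussianMinorant (d / (2 * M ^ 2)) ω ≤ Φhat ω := by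
  have hd0 : (0 : ℝ) < d := by exact_mod_cast hd
  have hT := fourierInf_nonneg h M
  rcases le_or_gt (euclNorm ω) (2 * M) with hω | hω
  · have h1 : fourierInf Φhat M ≤ Φhat ω :=
      csInf_le ⟨0, by rintro _ ⟨v, -, rfl⟩; exact h v⟩ ⟨ω, hω, rfl⟩
    have h2 := gaussianMinorant_le_one (b := d / (2 * M ^ 2)) (by positivity) ω
    nlinarith
  · refine le_trans (mul_nonpos_of_nonneg_of_nonpos hT (gaussianMinorant_nonpos ?_)) (h ω)
    have h3 : (2 * M) ^ 2 ≤ euclNorm ω ^ 2 := pow_le_pow_left₀ (by positivity) hω.le 2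
    rw [div_mul_eq_mul_div, le_div_iff₀ (by positivity)]
    nlinarith

lemma two_pi_rpow_neg_half (d : ℕ) : (2 * π) ^ (-(d : ℝ) / 2) = (√2 ^ d * √π ^ d)⁻¹ := by
  rw [neg_div, Real.rpow_neg (by positivity), ← mul_pow, ← Real.sqrt_mul (by norm_num),
    Real.sqrt_eq_rpow, ← Real.rpow_natCast, ← Real.rpow_mul (by positivity)]
  congr 2
  ring

lemma two_rpow_three_halves : (2 : ℝ) ^ ((3 : ℝ) / 2) = 2 * √2 := by
  rw [show (3 : ℝ) / 2 = 1 + 1 / 2 by norm_num, Real.rpow_add (by norm_num), Real.rpow_one,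
    Real.sqrt_eq_rpow]

lemma sqrt_div_two_mul_sq {d : ℕ} {M : ℝ} (hM : 0 < M) :
    √((d : ℝ) / (2 * M ^ 2)) = √d / (√2 * M) := by
  rw [Real.sqrt_div (by positivity), Real.sqrt_mul (by norm_num), Real.sqrt_sq hM.le]

lemma volume_term_le_transform_zero {d : ℕ} (hd : 1 ≤ d) {M : ℝ} (hM : 0 < M) :
    1 / Real.Gamma ((d : ℝ) / 2 + 1) * (M / 2 ^ ((3 : ℝ) / 2)) ^ d ≤
      (2 * π) ^ (-(d : ℝ) / 2) *
        gaussianMinorantTransform (d / (2 * M ^ 2)) (0 : Fin d → ℝ) := by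
  have hG := Gamma_half_pos d
  have hd0 : (0 : ℝ) < d := by exact_mod_cast hd
  have hs : 0 < √(d : ℝ) ^ d := by positivity
  have h0 : gaussianMinorantTransform (d / (2 * M ^ 2)) (0 : Fin d → ℝ) =
      (√π ^ d * (√2 ^ d * M ^ d) / √d ^ d) * (1 - (√2 / Real.exp 1) ^ d) := by
    have h1 : √(π / (d / (2 * M ^ 2))) = √π * (√2 * M) / √d := by
      rw [Real.sqrt_div (by positivity), sqrt_div_two_mul_sq hM, div_div_eq_mul_div]
    simp [gaussianMinorantTransform, euclNorm, h1, div_pow, mul_pow]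
  rw [h0, two_pi_rpow_neg_half, two_rpow_three_halves]
  have h2 := sqrt_pow_le_Gamma_mul_one_sub hd
  have h3 : (√2 ^ d * √π ^ d)⁻¹ *
      ((√π ^ d * (√2 ^ d * M ^ d) / √d ^ d) * (1 - (√2 / Real.exp 1) ^ d)) =
      M ^ d * (1 - (√2 / Real.exp 1) ^ d) / √d ^ d := by
    field_simp
  rw [h3, div_pow, one_div_mul_eq_div, div_div, div_le_div_iff₀ (by positivity) hs]
  have h4 := mul_le_mul_of_nonneg_left h2 (pow_nonneg hM.le d)
  linarith

lemma sqrt_natCast_le_sqrt_two_pow (d : ℕ) : √(d : ℝ) ≤ √2 ^ d := by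
  rw [Real.sqrt_le_left (by positivity), ← pow_mul, mul_comm, pow_mul,
    Real.sq_sqrt (by norm_num)]
  exact_mod_cast d.lt_two_pow_self.le

lemma interaction_term_le {d : ℕ} {c q r : ℝ} (hc : 0 < c) (hq : 0 < q) (hr : 0 < r) :
    (2 * π) ^ (-(d : ℝ) / 2) * (√π ^ d * √18 ^ d * Real.Gamma ((d : ℝ) / 2 + 1) *
        √(d / (2 * (c / q) ^ 2)) / (r * q ^ d)) ≤
      1 / Real.Gamma ((d : ℝ) / 2 + 1) * (c / q / 2 ^ ((3 : ℝ) / 2)) ^ d *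
        (Real.Gamma ((d : ℝ) / 2 + 1) ^ 2 * π / 18 * (q / r) * (12 / c) ^ (d + 1)) := by
  have hG := Gamma_half_pos d
  have hs2 : √2 ^ 2 = (2 : ℝ) := Real.sq_sqrt (by norm_num)
  have hs2p : 0 < √(2 : ℝ) := by positivity
  have h18 : √18 = 3 * √(2 : ℝ) := by
    rw [show (18 : ℝ) = 3 ^ 2 * 2 by norm_num, Real.sqrt_mul (by norm_num),
      Real.sqrt_sq (by norm_num)]
  have h12 : (12 : ℝ) = 3 * √2 * (2 * √2) := by nlinarith
  have hL : (2 * π) ^ (-(d : ℝ) / 2) * (√π ^ d * √18 ^ d * Real.Gamma ((d : ℝ) / 2 + 1) *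
        √(d / (2 * (c / q) ^ 2)) / (r * q ^ d)) =
      3 ^ d * Real.Gamma ((d : ℝ) / 2 + 1) * q / (c * r * q ^ d) * (√d / √2) := by
    rw [two_pi_rpow_neg_half, sqrt_div_two_mul_sq (by positivity), h18, mul_pow]
    field_simp
  have hR : 1 / Real.Gamma ((d : ℝ) / 2 + 1) * (c / q / 2 ^ ((3 : ℝ) / 2)) ^ d *
        (Real.Gamma ((d : ℝ) / 2 + 1) ^ 2 * π / 18 * (q / r) * (12 / c) ^ (d + 1)) =
      3 ^ d * Real.Gamma ((d : ℝ) / 2 + 1) * q / (c * r * q ^ d) * (√2 ^ d * (2 * π / 3)) := by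
    have h12d : (12 : ℝ) ^ d = 3 ^ d * √2 ^ d * (2 * √2) ^ d := by
      rw [← mul_pow, ← mul_pow, ← h12]
    rw [two_rpow_three_halves, div_pow, div_pow, div_pow, pow_succ 12, pow_succ c, h12d]
    field_simp
    norm_num
  rw [hL, hR]
  refine mul_le_mul_of_nonneg_left ?_ (by positivity)
  have h1 : √(d : ℝ) / √2 ≤ √d :=
    div_le_self (Real.sqrt_nonneg _) (Real.one_le_sqrt.2 (by norm_num))
  have h2 : (1 : ℝ) ≤ 2 * π / 3 := by linarith [Real.pi_gt_three]
  have h3 : 0 ≤ √(2 : ℝ) ^ d := by positivity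
  nlinarith [sqrt_natCast_le_sqrt_two_pow d]

/-- Theorem 4 (separation distance lower bound on the kernel quadratic form): for a
continuous, integrable, even positive definite kernel `Φ` with nonnegative integrable
Fourier transform `Φ̂`, pairwise distinct points `x₁,…,xₙ` with separation distances
`q_j`, `q`, and any `c* > 0`,
`Σⱼ Σₖ αⱼαₖ Φ(xⱼ−xₖ) ≥ Υ₀(c*/q)·Σⱼ αⱼ²(1 − (Γ(d/2+1)²π/18)(q/qⱼ)(12/c*)^{d+1})`. -/
theorem separation_quadratic_form_bound {d n : ℕ} (hd : 1 ≤ d) (hn : 2 ≤ n)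
    (Φ : (Fin d → ℝ) → ℝ) (Φhat : (Fin d → ℝ) → ℝ)
    (hΦcont : Continuous Φ) (hΦint : Integrable Φ)
    (hΦeven : ∀ x, Φ (-x) = Φ x)
    (hΦhat_def : ∀ ω, (Φhat ω : ℂ) =
      (((2 * π) ^ (-(d : ℝ) / 2) : ℝ) : ℂ) *
        ∫ x, (Φ x : ℂ) * Complex.exp (-(Complex.I * ((∑ i, ω i * x i : ℝ) : ℂ))))
    (hΦhat_nonneg : ∀ ω, 0 ≤ Φhat ω)
    (hΦhat_int : Integrable Φhat)
    (hΦinv : ∀ x, (Φ x : ℂ) =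
      (((2 * π) ^ (-(d : ℝ) / 2) : ℝ) : ℂ) *
        ∫ ω, (Φhat ω : ℂ) * Complex.exp (Complex.I * ((∑ i, ω i * x i : ℝ) : ℂ)))
    (X : Fin n → (Fin d → ℝ)) (hX : Function.Injective X)
    (c : ℝ) (hc : 0 < c) :
    ∀ α : Fin n → ℝ,
      ∑ j, ∑ k, α j * α k * Φ (X j - X k) ≥
        Upsilon0 Φhat (c / sep X) *
          ∑ j, α j ^ 2 *
            (1 - Real.Gamma ((d : ℝ) / 2 + 1) ^ 2 * π / 18 * (sep X / sepj X j) *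
              (12 / c) ^ (d + 1)) := by
  intro α
  have hq := sep_pos hn hX
  have hd0 : (0 : ℝ) < d := by exact_mod_cast hd
  set M := c / sep X with hMdef
  have hM : 0 < M := by positivity
  set b : ℝ := d / (2 * M ^ 2) with hb_def
  have hb : 0 < b := by positivity
  set T := fourierInf Φhat M with hT_def
  have hT : 0 ≤ T := fourierInf_nonneg hΦhat_nonneg M
  set P : ℝ := (2 * π) ^ (-(d : ℝ) / 2) with hP_def
  have hP : 0 < P := by positivity
  have hw : Integrable (gaussianMinorant b : (Fin d → ℝ) → ℝ) := integrable_gaussianMinorant hb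
  have hform : T * ∑ j, ∑ k, α j * α k * gaussianMinorantTransform b (X j - X k) ≤
      ∑ j, ∑ k, α j * α k * ∫ ω, Φhat ω * Real.cos (∑ i, ω i * (X j - X k) i) := by
    have h := quadratic_form_cos_transform_nonneg
      (D := fun ω => Φhat ω - T * gaussianMinorant b ω) (hΦhat_int.sub (hw.const_mul T))
      (fun ω => sub_nonneg.2 (fourierInf_mul_gaussianMinorant_le hd hΦhat_nonneg hM ω)) X α
    have hsplit : ∀ x : Fin d → ℝ,
        ∫ v, (Φhat v - T * gaussianMinorant b v) * Real.cos (∑ i, v i * x i) =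
          (∫ v, Φhat v * Real.cos (∑ i, v i * x i)) - T * gaussianMinorantTransform b x := by
      intro x
      rw [← integral_gaussianMinorant_mul_cos hb, ← integral_const_mul,
        ← integral_sub (integrable_mul_cos hΦhat_int x) ((integrable_mul_cos hw x).const_mul T)]
      refine integral_congr_ae (ae_of_all _ fun v => ?_)
      ring
    simp only [hsplit, mul_sub, Finset.sum_sub_distrib] at h
    rw [sub_nonneg] at h
    refine le_trans (le_of_eq ?_) h
    simp only [Finset.mul_sum]
    exact Finset.sum_congr rfl fun j _ => Finset.sum_congr rfl fun k _ => by ring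
  have hdiag := sum_sq_mul_le_quadratic_form
    (fun j k => gaussianMinorantTransform b (X j - X k))
    (fun j k => by simp only [gaussianMinorantTransform, euclNorm_sub_comm (X j)])
    (fun j k => gaussianMinorantTransform_nonneg hb _) α
  have hterm : ∀ j, 1 / Real.Gamma ((d : ℝ) / 2 + 1) * (M / 2 ^ ((3 : ℝ) / 2)) ^ d *
      (1 - Real.Gamma ((d : ℝ) / 2 + 1) ^ 2 * π / 18 * (sep X / sepj X j) *
        (12 / c) ^ (d + 1)) ≤
      P * (gaussianMinorantTransform b (X j - X j) -
        ∑ k ∈ Finset.univ.erase j, gaussianMinorantTransform b (X j - X k)) := by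
    intro j
    have h1 := volume_term_le_transform_zero hd hM
    have h2 := interaction_term_le (d := d) hc hq (sepj_pos hn hX j)
    have h3 := mul_le_mul_of_nonneg_left (sum_gaussianMinorantTransform_le hd hn hX hb j) hP.le
    rw [sub_self, mul_sub, mul_sub, mul_one]
    linarith
  have hΦsum : ∑ j, ∑ k, α j * α k * Φ (X j - X k) =
      P * ∑ j, ∑ k, α j * α k * ∫ ω, Φhat ω * Real.cos (∑ i, ω i * (X j - X k) i) := by
    simp only [Finset.mul_sum]
    refine Finset.sum_congr rfl fun j _ => Finset.sum_congr rfl fun k _ => ?_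
    rw [eq_cos_transform_of_inversion hΦhat_int _ (hΦinv (X j - X k))]
    ring
  rw [ge_iff_le, hΦsum]
  calc _ = T * ∑ j, α j ^ 2 * (1 / Real.Gamma ((d : ℝ) / 2 + 1) *
          (M / 2 ^ ((3 : ℝ) / 2)) ^ d *
          (1 - Real.Gamma ((d : ℝ) / 2 + 1) ^ 2 * π / 18 * (sep X / sepj X j) *
            (12 / c) ^ (d + 1))) := by
        rw [Upsilon0, Finset.mul_sum, Finset.mul_sum]
        exact Finset.sum_congr rfl fun j _ => by ring
    _ ≤ T * ∑ j, α j ^ 2 * (P * (gaussianMinorantTransform b (X j - X j) -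
          ∑ k ∈ Finset.univ.erase j, gaussianMinorantTransform b (X j - X k))) :=
        mul_le_mul_of_nonneg_left (Finset.sum_le_sum fun j _ =>
          mul_le_mul_of_nonneg_left (hterm j) (sq_nonneg _)) hT
    _ = P * (T * ∑ j, α j ^ 2 * (gaussianMinorantTransform b (X j - X j) -
          ∑ k ∈ Finset.univ.erase j, gaussianMinorantTransform b (X j - X k))) := by
        simp only [Finset.mul_sum (s := Finset.univ (α := Fin n))]
        exact Finset.sum_congr rfl fun j _ => by ring
    _ ≤ P * (T * ∑ j, ∑ k, α j * α k * gaussianMinorantTransform b (X j - X k)) :=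
        mul_le_mul_of_nonneg_left (mul_le_mul_of_nonneg_left hdiag hT) hP.le
    _ ≤ _ := mul_le_mul_of_nonneg_left hform hP.le
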